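/- Let (X, 𝓑, μ, T) be an ergodic m.t.d.s. and 𝓤 a cover of X. Then h_μ^+(𝓤, T) = h_μ^−(𝓤, T). -/

import Mathlib

open MeasureTheory Filter Topology
open scoped Classical

variable {X : Type*} [MeasurableSpace X]

noncomputable def cJoin (U V : Finset (Set X)) : Finset (Set X) :=
  (U ×ˢ V).image fun p => p.1 ∩ p.2

noncomputable def preC (S : X → X) (U : Finset (Set X)) : Finset (Set X) :=
  U.image fun A => S ⁻¹' A

noncomputable def joinN (S : X → X) (U : Finset (Set X)) : ℕ → Finset (Set X)
  | 0 => {Set.univ}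
  | n + 1 => cJoin (joinN S U n) (preC (S^[n]) U)

def IsMCover (U : Finset (Set X)) : Prop :=
  (∀ A ∈ U, MeasurableSet A) ∧ ⋃₀ (U : Set (Set X)) = Set.univ

def IsMPartition (U : Finset (Set X)) : Prop :=
  IsMCover U ∧ ∀ A ∈ U, ∀ B ∈ U, A ≠ B → Disjoint A B

def Refines (α U : Finset (Set X)) : Prop := ∀ A ∈ α, ∃ B ∈ U, A ⊆ B

noncomputable def entPart (μ : Measure X) (α : Finset (Set X)) : ℝ :=
  ∑ A ∈ α, Real.negMulLog (μ A).toReal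

noncomputable def entCover (μ : Measure X) (U : Finset (Set X)) : ℝ :=
  sInf {h | ∃ α : Finset (Set X), IsMPartition α ∧ Refines α U ∧ h = entPart μ α}

noncomputable def hPart (μ : Measure X) (S : X → X) (α : Finset (Set X)) : ℝ :=
  limUnder atTop fun n : ℕ => entPart μ (joinN S α n) / n

noncomputable def hPlusC (μ : Measure X) (S : X → X) (U : Finset (Set X)) : ℝ :=
  sInf {h | ∃ α : Finset (Set X), IsMPartition α ∧ Refines α U ∧ h = hPart μ S α}

noncomputable def hMinusC (μ : Measure X) (S : X → X) (U : Finset (Set X)) : ℝ :=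
  limUnder atTop fun n : ℕ => entCover μ (joinN S U n) / n

noncomputable def covN (μ : Measure X) (V : Finset (Set X)) (ε : ℝ) : ℕ :=
  sInf {m | ∃ W ⊆ V, W.card = m ∧ 1 - ε < (μ (⋃₀ (W : Set (Set X)))).toReal}

noncomputable def covNfull (V : Finset (Set X)) : ℕ :=
  sInf {m | ∃ W ⊆ V, W.card = m ∧ ⋃₀ (W : Set (Set X)) = Set.univ}

/-! ### Entropy of finite-valued observables -/

/-- A map all of whose fibres are measurable. -/
def IsObs {ι : Type*} (f : X → ι) : Prop := ∀ i, MeasurableSet (f ⁻¹' {i})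

/-- The Shannon entropy of a finite-valued map. -/
noncomputable def obsEnt {ι : Type*} [Fintype ι] (μ : Measure X) (f : X → ι) : ℝ :=
  ∑ i, Real.negMulLog (μ.real (f ⁻¹' {i}))

/-- The partition of the space into the fibres of a finite-valued map. -/
noncomputable def fiberPart {ι : Type*} [Fintype ι] (f : X → ι) : Finset (Set X) :=
  Finset.univ.image fun i => f ⁻¹' {i}

lemma negMulLog_add_le {x y : ℝ} (hx : 0 ≤ x) (hy : 0 ≤ y) :
    Real.negMulLog (x + y) ≤ Real.negMulLog x + Real.negMulLog y := by
  rcases hx.eq_or_lt with rfl | hx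
  · simp
  rcases hy.eq_or_lt with rfl | hy
  · simp
  have h1 : Real.log x ≤ Real.log (x + y) := Real.log_le_log hx (by linarith)
  have h2 : Real.log y ≤ Real.log (x + y) := Real.log_le_log hy (by linarith)
  simp only [Real.negMulLog]
  nlinarith

lemma negMulLog_sum_le {ι : Type*} (s : Finset ι) (p : ι → ℝ) (hp : ∀ i, 0 ≤ p i) :
    Real.negMulLog (∑ i ∈ s, p i) ≤ ∑ i ∈ s, Real.negMulLog (p i) :=
  Finset.le_sum_of_subadditive_on_pred _ (fun x => 0 ≤ x) (by simp)
    (fun _ _ => negMulLog_add_le) (fun _ _ => add_nonneg) p (fun i _ => hp i)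

lemma negMulLog_le_one_sub {x : ℝ} (hx : 0 ≤ x) : Real.negMulLog x ≤ 1 - x := by
  rcases hx.eq_or_lt with rfl | hx
  · simp
  have h := Real.one_sub_inv_le_log_of_pos hx
  have h2 : x * (1 - x⁻¹) ≤ x * Real.log x := by gcongr
  rw [mul_sub, mul_inv_cancel₀ hx.ne'] at h2
  simp only [Real.negMulLog]
  linarith

lemma negMulLog_le_of_le {p q r : ℝ} (hp : 0 ≤ p) (hq : p ≤ q) (hr : p ≤ r) :
    Real.negMulLog p ≤ -p * Real.log q - p * Real.log r + (q * r - p) := by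
  rcases hp.eq_or_lt with rfl | hp
  · simpa using mul_nonneg hq hr
  have hq' := hp.trans_le hq
  have hr' := hp.trans_le hr
  have h := Real.log_le_sub_one_of_pos (show 0 < q * r / p by positivity)
  rw [Real.log_div (by positivity) hp.ne', Real.log_mul hq'.ne' hr'.ne'] at h
  have h2 := mul_le_mul_of_nonneg_left h hp.le
  rw [mul_sub p (q * r / p), mul_div_cancel₀ _ hp.ne'] at h2
  simp only [Real.negMulLog]
  linarith

lemma sum_negMulLog_le_of_marginals {ι κ : Type*} [Fintype ι] [Fintype κ] (p : ι → κ → ℝ)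
    (hp : ∀ i j, 0 ≤ p i j) (h1 : ∑ i, ∑ j, p i j = 1) :
    ∑ i, ∑ j, Real.negMulLog (p i j) ≤
      ∑ i, Real.negMulLog (∑ j, p i j) + ∑ j, Real.negMulLog (∑ i, p i j) := by
  have hterm : ∀ i j, Real.negMulLog (p i j) ≤ -p i j * Real.log (∑ j, p i j)
      - p i j * Real.log (∑ i, p i j) + ((∑ j, p i j) * (∑ i, p i j) - p i j) := fun i j =>
    negMulLog_le_of_le (hp i j)
      (Finset.single_le_sum (f := fun j => p i j) (fun j _ => hp i j) (Finset.mem_univ j))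
      (Finset.single_le_sum (f := fun i => p i j) (fun i _ => hp i j) (Finset.mem_univ i))
  refine (Finset.sum_le_sum fun i _ => Finset.sum_le_sum fun j _ => hterm i j).trans_eq ?_
  simp only [Finset.sum_add_distrib, Finset.sum_sub_distrib, ← Finset.mul_sum, ← Finset.sum_mul,
    h1]
  have h2 : ∑ j, ∑ i, p i j = 1 := by rw [Finset.sum_comm, h1]
  rw [Finset.sum_comm (f := fun i j => p i j * Real.log (∑ i, p i j))]
  simp only [← Finset.sum_mul, h2, Real.negMulLog, Finset.sum_neg_distrib, neg_mul]
  ring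

lemma IsObs.preimage {ι : Type*} [Fintype ι] {f : X → ι} (hf : IsObs f) (s : Set ι) :
    MeasurableSet (f ⁻¹' s) := by
  rw [← Set.biUnion_preimage_singleton]
  exact MeasurableSet.biUnion s.to_countable fun i _ => hf i

lemma IsObs.comp_left {ι κ : Type*} [Fintype ι] {f : X → ι} (hf : IsObs f) (φ : ι → κ) :
    IsObs fun x => φ (f x) :=
  fun j => hf.preimage (φ ⁻¹' {j})

lemma IsObs.comp_right {ι : Type*} {f : X → ι} (hf : IsObs f) {S : X → X} (hS : Measurable S) :
    IsObs fun x => f (S x) := fun j => hS (hf j)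

lemma IsObs.prodMk {ι κ : Type*} {f : X → ι} {g : X → κ} (hf : IsObs f) (hg : IsObs g) :
    IsObs fun x => (f x, g x) := by
  rintro ⟨i, j⟩
  convert (hf i).inter (hg j) using 1
  ext x; simp

lemma IsObs.pi {ι : Type*} {N : ℕ} {f : Fin N → X → ι} (hf : ∀ k, IsObs (f k)) :
    IsObs fun x k => f k x := by
  intro w
  convert MeasurableSet.iInter fun k => hf k (w k) using 1
  ext x; simp [funext_iff]

section Observables

variable {ι κ : Type*} [Fintype ι] [Fintype κ] {μ : Measure X}

lemma IsObs.sum_measureReal_inter [IsFiniteMeasure μ] {f : X → ι} (hf : IsObs f) (A : Set X) :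
    ∑ i, μ.real (A ∩ f ⁻¹' {i}) = μ.real A := by
  have := MeasureTheory.sum_measure_preimage_singleton (μ := μ.restrict A) Finset.univ
    (f := f) (fun i _ => hf i)
  simp only [Finset.coe_univ, Set.preimage_univ, Measure.restrict_apply_univ,
    Measure.restrict_apply (hf _)] at this
  simp only [measureReal_def, ← this]
  rw [ENNReal.toReal_sum fun _ _ => measure_ne_top _ _]
  simp [Set.inter_comm]

lemma obsEnt_nonneg [IsProbabilityMeasure μ] (f : X → ι) : 0 ≤ obsEnt μ f :=
  Finset.sum_nonneg fun _ _ => Real.negMulLog_nonneg measureReal_nonneg measureReal_le_one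

lemma obsEnt_comp_left_le [IsFiniteMeasure μ] {f : X → ι} (hf : IsObs f) (φ : ι → κ) :
    obsEnt μ (fun x => φ (f x)) ≤ obsEnt μ f := by
  have h : ∀ j, μ.real ((fun x => φ (f x)) ⁻¹' {j}) = ∑ i with φ i = j, μ.real (f ⁻¹' {i}) := by
    intro j
    rw [← hf.sum_measureReal_inter, Finset.sum_filter]
    refine Finset.sum_congr rfl fun i _ => ?_
    split_ifs with hij
    · congr 1; ext x; simp; rintro rfl; exact hij
    · convert measureReal_empty (μ := μ)
      ext x; simp; rintro h rfl; exact hij h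
  unfold obsEnt
  rw [← Finset.sum_fiberwise Finset.univ φ]
  refine Finset.sum_le_sum fun j _ => ?_
  rw [h]
  exact negMulLog_sum_le _ _ fun _ => measureReal_nonneg

lemma obsEnt_comp_right {f : X → ι} (hf : IsObs f) {S : X → X} (hS : MeasurePreserving S μ μ) :
    obsEnt μ (fun x => f (S x)) = obsEnt μ f :=
  Finset.sum_congr rfl fun i _ => by
    rw [measureReal_def, measureReal_def, ← hS.measure_preimage (hf i).nullMeasurableSet]; rfl

lemma obsEnt_prodMk (f : X → ι) (g : X → κ) : obsEnt μ (fun x => (f x, g x)) =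
    ∑ i, ∑ j, Real.negMulLog (μ.real (f ⁻¹' {i} ∩ g ⁻¹' {j})) := by
  rw [obsEnt, Fintype.sum_prod_type]
  refine Finset.sum_congr rfl fun i _ => Finset.sum_congr rfl fun j _ => ?_
  congr 2; ext x; simp

lemma obsEnt_prodMk_le [IsProbabilityMeasure μ] {f : X → ι} {g : X → κ} (hf : IsObs f)
    (hg : IsObs g) : obsEnt μ (fun x => (f x, g x)) ≤ obsEnt μ f + obsEnt μ g := by
  rw [obsEnt_prodMk]
  refine (sum_negMulLog_le_of_marginals _ (fun _ _ => measureReal_nonneg) ?_).trans_eq ?_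
  · simp only [hg.sum_measureReal_inter]
    simpa using hf.sum_measureReal_inter (μ := μ) Set.univ
  · congr 1
    · simp only [hg.sum_measureReal_inter]
      rfl
    · simp only [Set.inter_comm (f ⁻¹' _), hf.sum_measureReal_inter]
      rfl

lemma obsEnt_pi_le [IsProbabilityMeasure μ] {N : ℕ} {f : Fin N → X → ι}
    (hf : ∀ k, IsObs (f k)) : obsEnt μ (fun x k => f k x) ≤ ∑ k, obsEnt μ (f k) := by
  induction N with
  | zero => simp [obsEnt, Set.preimage, Subsingleton.elim _ (default : Fin 0 → ι)]
  | succ N ih =>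
    rw [Fin.sum_univ_castSucc]
    have h1 : IsObs fun x (k : Fin N) => f k.castSucc x := IsObs.pi fun k => hf k.castSucc
    have h2 := obsEnt_comp_left_le (μ := μ) (h1.prodMk (hf (Fin.last N)))
      fun p => (Fin.snoc p.1 p.2 : Fin (N + 1) → ι)
    have h3 := obsEnt_prodMk_le (μ := μ) h1 (hf (Fin.last N))
    have h4 := ih (f := fun k => f k.castSucc) fun k => hf _
    have h5 : (fun x (k : Fin (N + 1)) => f k x) = fun x =>
        (Fin.snoc (fun k : Fin N => f k.castSucc x) (f (Fin.last N) x) : Fin (N + 1) → ι) := by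
      funext x k
      refine Fin.lastCases ?_ (fun k => ?_) k <;> simp
    rw [h5]
    linarith

end Observables

/-! ### Entropy of partitions -/

lemma Refines.trans {Y : Type*} {α β γ : Finset (Set Y)} (h1 : Refines α β) (h2 : Refines β γ) :
    Refines α γ := by
  intro A hA
  obtain ⟨B, hB, hAB⟩ := h1 A hA
  obtain ⟨C, hC, hBC⟩ := h2 B hB
  exact ⟨C, hC, hAB.trans hBC⟩

section Partitions

variable {ι : Type*} [Fintype ι] {μ : Measure X}

lemma isMPartition_fiberPart {f : X → ι} (hf : IsObs f) : IsMPartition (fiberPart f) := by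
  refine ⟨⟨?_, ?_⟩, ?_⟩
  · intro A hA
    obtain ⟨i, -, rfl⟩ := Finset.mem_image.1 hA
    exact hf i
  · ext x; simp [fiberPart]
  · intro A hA B hB hAB
    obtain ⟨i, -, rfl⟩ := Finset.mem_image.1 hA
    obtain ⟨j, -, rfl⟩ := Finset.mem_image.1 hB
    have : i ≠ j := by rintro rfl; exact hAB rfl
    exact Disjoint.preimage f (by simpa using this)

lemma entPart_fiberPart (f : X → ι) : entPart μ (fiberPart f) = obsEnt μ f := by
  unfold entPart fiberPart obsEnt
  rw [Finset.sum_image_of_pairwise_eq_zero]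
  · rfl
  · intro i _ j _ hij h
    have : f ⁻¹' {i} = ∅ := by
      have hd : Disjoint (f ⁻¹' {i}) (f ⁻¹' {j}) := Disjoint.preimage f (by simpa using hij)
      rw [← h] at hd
      simpa using hd
    simp [this]

lemma exists_obs_of_isMPartition {α : Finset (Set X)} (hα : IsMPartition α) :
    ∃ f : X → α, (∀ A : α, f ⁻¹' {A} = A) ∧ IsObs f ∧ entPart μ α = obsEnt μ f := by
  have hex : ∀ x, ∃ A : α, x ∈ (A : Set X) := by
    intro x
    have : x ∈ ⋃₀ (α : Set (Set X)) := by rw [hα.1.2]; trivial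
    obtain ⟨A, hA, hx⟩ := this
    exact ⟨⟨A, hA⟩, hx⟩
  choose f hf using hex
  have hfib : ∀ A : α, f ⁻¹' {A} = A := by
    intro A
    ext x
    refine ⟨?_, fun hx => ?_⟩
    · rintro rfl; exact hf x
    · by_contra hne
      have := hα.2 _ (f x).2 _ A.2 fun h => hne (Subtype.ext h)
      exact Set.disjoint_left.1 this (hf x) hx
  refine ⟨f, hfib, fun A => by rw [hfib]; exact hα.1.1 _ A.2, ?_⟩
  unfold entPart obsEnt
  simp only [hfib]
  exact (Finset.sum_coe_sort α fun A => Real.negMulLog (μ A).toReal).symm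

lemma entPart_nonneg [IsProbabilityMeasure μ] (α : Finset (Set X)) : 0 ≤ entPart μ α :=
  Finset.sum_nonneg fun A _ =>
    Real.negMulLog_nonneg measureReal_nonneg (measureReal_le_one (μ := μ) (s := A))

lemma entPart_mono [IsFiniteMeasure μ] {α β : Finset (Set X)} (hα : IsMPartition α)
    (hβ : IsMPartition β) (h : Refines β α) : entPart μ α ≤ entPart μ β := by
  obtain ⟨f, hf, -, hfe⟩ := exists_obs_of_isMPartition (μ := μ) hα
  obtain ⟨g, hg, hgo, hge⟩ := exists_obs_of_isMPartition (μ := μ) hβ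
  choose φ hφ hφ' using fun B : β => h B B.2
  have : f = fun x => (fun B => (⟨φ B, hφ B⟩ : α)) (g x) := by
    funext x
    have hx : x ∈ (g x : Set X) := by
      rw [← hg (g x)]
      exact rfl
    have hx' : x ∈ f ⁻¹' {⟨φ (g x), hφ (g x)⟩} := by
      rw [hf]
      exact hφ' (g x) hx
    exact hx'
  rw [hfe, hge, this]
  exact obsEnt_comp_left_le hgo fun B => (⟨φ B, hφ B⟩ : α)

end Partitions

/-! ### Iterated joins and the entropy of covers -/

lemma mem_joinN {Y : Type*} {S : Y → Y} {U : Finset (Set Y)} {n : ℕ} {A : Set Y} :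
    A ∈ joinN S U n ↔ ∃ s : ℕ → Set Y, (∀ i < n, s i ∈ U) ∧ A = {x | ∀ i < n, S^[i] x ∈ s i} := by
  induction n generalizing A with
  | zero => simp [joinN, Set.eq_univ_iff_forall]
  | succ n ih =>
    simp only [joinN, cJoin, preC, Finset.mem_image, Finset.mem_product, Prod.exists]
    constructor
    · rintro ⟨B, C, ⟨hB, V, hV, rfl⟩, rfl⟩
      obtain ⟨s, hs, rfl⟩ := ih.1 hB
      refine ⟨Function.update s n V, fun i hi => ?_, ?_⟩
      · rcases (Nat.lt_succ_iff_lt_or_eq.1 hi) with h | rfl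
        · rw [Function.update_of_ne h.ne]; exact hs i h
        · simpa using hV
      · ext x
        simp only [Set.mem_inter_iff, Set.mem_ofPred_eq, Set.mem_preimage, Nat.forall_lt_succ_right,
          Function.update_self]
        refine and_congr_left fun _ => forall₂_congr fun i hi => ?_
        rw [Function.update_of_ne hi.ne]
    · rintro ⟨s, hs, rfl⟩
      refine ⟨_, _, ⟨ih.2 ⟨s, fun i hi => hs i (hi.trans n.lt_succ_self), rfl⟩,
        s n, hs n n.lt_succ_self, rfl⟩, ?_⟩
      ext x
      simp only [Set.mem_inter_iff, Set.mem_ofPred_eq, Set.mem_preimage, Nat.forall_lt_succ_right]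

lemma refines_joinN {Y : Type*} {α U : Finset (Set Y)} (h : Refines α U) (S : Y → Y) (n : ℕ) :
    Refines (joinN S α n) (joinN S U n) := by
  intro A hA
  obtain ⟨s, hs, rfl⟩ := mem_joinN.1 hA
  choose! t ht hst using h
  exact ⟨_, mem_joinN.2 ⟨fun i => t (s i), fun i hi => ht _ (hs i hi), rfl⟩,
    fun x hx i hi => hst _ (hs i hi) (hx i hi)⟩

lemma isMCover_joinN {U : Finset (Set X)} (hU : IsMCover U) {S : X → X} (hS : Measurable S)
    (n : ℕ) : IsMCover (joinN S U n) := by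
  constructor
  · intro A hA
    obtain ⟨s, hs, rfl⟩ := mem_joinN.1 hA
    have : {x | ∀ i < n, S^[i] x ∈ s i} = ⋂ i, ⋂ (_ : i < n), S^[i] ⁻¹' s i := by ext x; simp
    rw [this]
    exact MeasurableSet.iInter fun i => MeasurableSet.iInter fun hi =>
      (hS.iterate i) (hU.1 _ (hs i hi))
  · refine Set.eq_univ_of_forall fun x => ?_
    have hx : ∀ i, ∃ A ∈ (U : Set (Set X)), S^[i] x ∈ A := fun i => by
      rw [← Set.mem_sUnion, hU.2]; trivial
    choose s hs hxs using hx
    exact ⟨_, mem_joinN.2 ⟨s, fun i _ => hs i, rfl⟩, fun i _ => hxs i⟩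

lemma isMPartition_joinN {α : Finset (Set X)} (hα : IsMPartition α) {S : X → X}
    (hS : Measurable S) (n : ℕ) : IsMPartition (joinN S α n) := by
  refine ⟨isMCover_joinN hα.1 hS n, fun A hA B hB hAB => ?_⟩
  obtain ⟨s, hs, rfl⟩ := mem_joinN.1 hA
  obtain ⟨t, ht, rfl⟩ := mem_joinN.1 hB
  rw [Set.disjoint_left]
  intro x hx hx'
  have hst : ∀ i < n, s i = t i := fun i hi => by
    by_contra hne
    exact Set.disjoint_left.1 (hα.2 _ (hs i hi) _ (ht i hi) hne) (hx i hi) (hx' i hi)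
  refine hAB (Set.ext fun y => forall₂_congr fun i hi => ?_)
  rw [hst i hi]

lemma isMPartition_preC {α : Finset (Set X)} (hα : IsMPartition α) {S : X → X}
    (hS : Measurable S) : IsMPartition (preC S α) := by
  refine ⟨⟨fun A hA => ?_, ?_⟩, fun A hA B hB hAB => ?_⟩
  · obtain ⟨B, hB, rfl⟩ := Finset.mem_image.1 hA
    exact hS (hα.1.1 B hB)
  · refine Set.eq_univ_of_forall fun x => ?_
    have hx : S x ∈ ⋃₀ (α : Set (Set X)) := by rw [hα.1.2]; trivial
    obtain ⟨A, hA, hx⟩ := hx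
    exact ⟨S ⁻¹' A, Finset.mem_image_of_mem _ hA, hx⟩
  · obtain ⟨C, hC, rfl⟩ := Finset.mem_image.1 hA
    obtain ⟨D, hD, rfl⟩ := Finset.mem_image.1 hB
    exact (hα.2 C hC D hD (by rintro rfl; exact hAB rfl)).preimage S

lemma entPart_preC {μ : Measure X} {α : Finset (Set X)} (hα : IsMPartition α) {S : X → X}
    (hS : MeasurePreserving S μ μ) : entPart μ (preC S α) = entPart μ α := by
  unfold entPart preC
  rw [Finset.sum_image_of_pairwise_eq_zero]
  · exact Finset.sum_congr rfl fun A hA => by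
      rw [hS.measure_preimage (hα.1.1 A hA).nullMeasurableSet]
  · intro A hA B hB hAB h
    have hd := (hα.2 A hA B hB hAB).preimage S
    rw [← h] at hd
    simp [disjoint_self.1 hd]

/-- A cover admits a measurable selector of its elements. -/
lemma exists_obs_mem_cover [Nonempty X] {U : Finset (Set X)} (hU : IsMCover U) :
    ∃ f : X → U, IsObs f ∧ ∀ x, x ∈ (f x : Set X) := by
  have hex : ∀ x, ∃ A : U, x ∈ (A : Set X) := fun x => by
    have hx : x ∈ ⋃₀ (U : Set (Set X)) := by rw [hU.2]; trivial
    obtain ⟨A, hA, hx⟩ := hx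
    exact ⟨⟨A, hA⟩, hx⟩
  have : Nonempty U := ⟨(hex (Classical.arbitrary X)).choose⟩
  let p : X → U → Prop := fun x A => x ∈ (A : Set X)
  have hp : IsObs p := by
    intro w
    have : p ⁻¹' {w} = ⋂ A : U, {x | x ∈ (A : Set X) ↔ w A} := by
      ext x; simp [p, funext_iff]
    rw [this]
    refine MeasurableSet.iInter fun A => ?_
    by_cases hw : w A
    · simpa [hw] using hU.1 A A.2
    · simp only [hw, iff_false]
      exact (hU.1 A A.2).compl
  have hsel : ∀ w : U → Prop, ∃ A : U, ∀ x, p x = w → x ∈ (A : Set X) := by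
    intro w
    by_cases hw : ∃ x, p x = w
    · obtain ⟨x, rfl⟩ := hw
      obtain ⟨A, hA⟩ := hex x
      refine ⟨A, fun y hy => ?_⟩
      have : p y A := by rw [hy]; exact hA
      exact this
    · exact ⟨Classical.arbitrary U, fun x hx => (hw ⟨x, hx⟩).elim⟩
  choose φ hφ using hsel
  exact ⟨fun x => φ (p x), hp.comp_left φ, fun x => hφ _ x rfl⟩

lemma refines_fiberPart {Y ι : Type*} [Fintype ι] {f : Y → ι} {U : Finset (Set Y)}
    (h : ∀ i, ∃ A ∈ U, ∀ x, f x = i → x ∈ A) : Refines (fiberPart f) U := by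
  intro B hB
  obtain ⟨i, -, rfl⟩ := Finset.mem_image.1 hB
  obtain ⟨A, hA, hi⟩ := h i
  exact ⟨A, hA, fun x hx => hi x hx⟩

lemma exists_isMPartition_refines [Nonempty X] {U : Finset (Set X)} (hU : IsMCover U) :
    ∃ α, IsMPartition α ∧ Refines α U := by
  obtain ⟨f, hf, hfm⟩ := exists_obs_mem_cover hU
  exact ⟨fiberPart f, isMPartition_fiberPart hf,
    refines_fiberPart fun A => ⟨A, A.2, fun x hx => hx ▸ hfm x⟩⟩

section CoverEntropy

variable {μ : Measure X} [IsProbabilityMeasure μ]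

lemma entCover_le {α V : Finset (Set X)} (hα : IsMPartition α) (h : Refines α V) :
    entCover μ V ≤ entPart μ α :=
  csInf_le ⟨0, by rintro _ ⟨α, -, -, rfl⟩; exact entPart_nonneg α⟩ ⟨α, hα, h, rfl⟩

lemma entCover_nonneg (V : Finset (Set X)) : 0 ≤ entCover μ V :=
  Real.sInf_nonneg (by rintro _ ⟨α, -, -, rfl⟩; exact entPart_nonneg α)

lemma exists_entPart_lt {V : Finset (Set X)} (hV : IsMCover V) {ε : ℝ} (hε : 0 < ε) :
    ∃ α, IsMPartition α ∧ Refines α V ∧ entPart μ α < entCover μ V + ε := by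
  have := nonempty_of_isProbabilityMeasure μ
  obtain ⟨α, hα, hαV⟩ := exists_isMPartition_refines hV
  obtain ⟨_, ⟨β, hβ, hβV, rfl⟩, h⟩ := exists_lt_of_csInf_lt
    (s := {h | ∃ α : Finset (Set X), IsMPartition α ∧ Refines α V ∧ h = entPart μ α})
    ⟨_, α, hα, hαV, rfl⟩ (lt_add_of_pos_right _ hε)
  exact ⟨β, hβ, hβV, h⟩

lemma entCover_of_isMPartition {α : Finset (Set X)} (hα : IsMPartition α) :
    entCover μ α = entPart μ α := by
  have hr : Refines α α := fun A hA => ⟨A, hA, subset_rfl⟩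
  refine (entCover_le hα hr).antisymm (le_csInf ⟨_, α, hα, hr, rfl⟩ ?_)
  rintro _ ⟨β, hβ, h, rfl⟩
  exact entPart_mono hα hβ h

lemma exists_common_refinement {α β : Finset (Set X)} (hα : IsMPartition α)
    (hβ : IsMPartition β) : ∃ γ, IsMPartition γ ∧ Refines γ (cJoin α β) ∧
      entPart μ γ ≤ entPart μ α + entPart μ β := by
  obtain ⟨f, hf, hfo, hfe⟩ := exists_obs_of_isMPartition (μ := μ) hα
  obtain ⟨g, hg, hgo, hge⟩ := exists_obs_of_isMPartition (μ := μ) hβ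
  refine ⟨fiberPart fun x => (f x, g x), isMPartition_fiberPart (hfo.prodMk hgo), ?_, ?_⟩
  · refine refines_fiberPart fun i => ⟨i.1 ∩ i.2, Finset.mem_image.2
      ⟨(i.1, i.2), Finset.mem_product.2 ⟨i.1.2, i.2.2⟩, rfl⟩, ?_⟩
    rintro x rfl
    refine ⟨?_, ?_⟩
    · rw [← hf]; exact rfl
    · rw [← hg]; exact rfl
  · rw [entPart_fiberPart, hfe, hge]
    exact obsEnt_prodMk_le hfo hgo

lemma subadditive_entCover_joinN {S : X → X} (hS : MeasurePreserving S μ μ)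
    {U : Finset (Set X)} (hU : IsMCover U) :
    Subadditive fun n => entCover μ (joinN S U n) := by
  intro m n
  refine le_of_forall_pos_le_add fun ε hε => ?_
  obtain ⟨α, hα, hαr, hαe⟩ :=
    exists_entPart_lt (μ := μ) (isMCover_joinN hU hS.measurable m) (half_pos hε)
  obtain ⟨β, hβ, hβr, hβe⟩ :=
    exists_entPart_lt (μ := μ) (isMCover_joinN hU hS.measurable n) (half_pos hε)
  have hSm := hS.iterate m
  obtain ⟨γ, hγ, hγr, hγe⟩ :=
    exists_common_refinement (μ := μ) hα (isMPartition_preC hβ hSm.measurable)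
  rw [entPart_preC hβ hSm] at hγe
  have : Refines γ (joinN S U (m + n)) := by
    refine hγr.trans fun C hC => ?_
    obtain ⟨⟨A, B⟩, hAB, rfl⟩ := Finset.mem_image.1 hC
    obtain ⟨hA, hB⟩ := Finset.mem_product.1 hAB
    obtain ⟨B, hB', rfl : S^[m] ⁻¹' B = _⟩ := Finset.mem_image.1 hB
    obtain ⟨_, hA', hA''⟩ := hαr A hA
    obtain ⟨_, hB', hB''⟩ := hβr B hB'
    obtain ⟨s, hs, rfl⟩ := mem_joinN.1 hA'
    obtain ⟨t, ht, rfl⟩ := mem_joinN.1 hB'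
    refine ⟨_, mem_joinN.2 ⟨fun i => if i < m then s i else t (i - m), fun i hi => ?_, rfl⟩, ?_⟩
    · dsimp only
      split_ifs with h
      · exact hs i h
      · exact ht _ (by omega)
    · rintro x ⟨hxA, hxB⟩ i hi
      dsimp only
      split_ifs with h
      · exact hA'' hxA i h
      · have := hB'' hxB (i - m) (by omega)
        rwa [← Function.iterate_add_apply, Nat.sub_add_cancel (by omega)] at this
  have := entCover_le (μ := μ) hγ this
  linarith

lemma tendsto_hMinusC {S : X → X} (hS : MeasurePreserving S μ μ) {U : Finset (Set X)}
    (hU : IsMCover U) :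
    Tendsto (fun n : ℕ => entCover μ (joinN S U n) / n) atTop (𝓝 (hMinusC μ S U)) := by
  have h := (subadditive_entCover_joinN hS hU).tendsto_lim
    ⟨0, by rintro _ ⟨n, rfl⟩; exact div_nonneg (entCover_nonneg _) n.cast_nonneg⟩
  unfold hMinusC
  rwa [h.limUnder_eq]

lemma tendsto_hPart {S : X → X} (hS : MeasurePreserving S μ μ) {α : Finset (Set X)}
    (hα : IsMPartition α) :
    Tendsto (fun n : ℕ => entPart μ (joinN S α n) / n) atTop (𝓝 (hPart μ S α)) := by
  have h := tendsto_hMinusC hS hα.1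
  simp only [entCover_of_isMPartition (isMPartition_joinN hα hS.measurable _)] at h
  unfold hPart
  rwa [h.limUnder_eq]

lemma hPart_nonneg {S : X → X} (hS : MeasurePreserving S μ μ) {α : Finset (Set X)}
    (hα : IsMPartition α) : 0 ≤ hPart μ S α :=
  ge_of_tendsto' (tendsto_hPart hS hα) fun n => div_nonneg (entPart_nonneg _) n.cast_nonneg

lemma hMinusC_nonneg {S : X → X} (hS : MeasurePreserving S μ μ) {U : Finset (Set X)}
    (hU : IsMCover U) : 0 ≤ hMinusC μ S U :=
  ge_of_tendsto' (tendsto_hMinusC hS hU) fun n => div_nonneg (entCover_nonneg _) n.cast_nonneg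

lemma hPlusC_le {S : X → X} (hS : MeasurePreserving S μ μ) {α U : Finset (Set X)}
    (hα : IsMPartition α) (h : Refines α U) : hPlusC μ S U ≤ hPart μ S α :=
  csInf_le ⟨0, by rintro _ ⟨α, hα, -, rfl⟩; exact hPart_nonneg hS hα⟩ ⟨α, hα, h, rfl⟩

lemma hMinusC_le_hPlusC {S : X → X} (hS : MeasurePreserving S μ μ) {U : Finset (Set X)}
    (hU : IsMCover U) : hMinusC μ S U ≤ hPlusC μ S U := by
  have := nonempty_of_isProbabilityMeasure μ
  obtain ⟨α, hα, hαU⟩ := exists_isMPartition_refines hU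
  refine le_csInf ⟨_, α, hα, hαU, rfl⟩ ?_
  rintro _ ⟨β, hβ, hβU, rfl⟩
  refine le_of_tendsto_of_tendsto' (tendsto_hMinusC hS hU) (tendsto_hPart hS hβ) fun n => ?_
  gcongr
  exact entCover_le (isMPartition_joinN hβ hS.measurable n) (refines_joinN hβU S n)

/-- If every itinerary of length `N` of the observable `g` determines an element of `U` containing
the last point of the orbit segment, then `h⁺(U)` is at most the entropy of `g`. -/
lemma hPlusC_le_obsEnt {T : X ≃ᵐ X} (hT : MeasurePreserving T μ μ) {U : Finset (Set X)}
    {κ : Type*} [Fintype κ] {g : X → κ} (hg : IsObs g) {N : ℕ}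
    (hgU : ∀ w : Fin (N + 1) → κ, ∃ A ∈ U,
      ∀ y, (∀ k : Fin (N + 1), g (T^[k] y) = w k) → T^[N] y ∈ A) :
    hPlusC μ T U ≤ obsEnt μ g := by
  choose Φ hΦU hΦ using hgU
  have hit : ∀ k, Measurable (T^[k]) := fun k => T.measurable.iterate k
  let Ψ : (Fin (N + 1) → κ) → U := fun w => ⟨Φ w, hΦU w⟩
  let a : X → U := fun x => Ψ fun k => g (T^[k] (T.symm^[N] x))
  have ha : IsObs a :=
    (IsObs.pi fun k : Fin (N + 1) =>
      hg.comp_right ((hit k).comp (T.symm.measurable.iterate N))).comp_left Ψ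
  have hα := isMPartition_fiberPart ha
  have hinv : ∀ x, T^[N] (T.symm^[N] x) = x :=
    (T.right_inv : Function.LeftInverse T T.symm).iterate N
  have hinv' : ∀ x, T.symm^[N] (T^[N] x) = x :=
    (T.left_inv : Function.LeftInverse T.symm T).iterate N
  have hαU : Refines (fiberPart a) U := by
    refine refines_fiberPart fun A => ⟨A, A.2, ?_⟩
    rintro x rfl
    have := hΦ _ (T.symm^[N] x) fun k => rfl
    rwa [hinv] at this
  refine (hPlusC_le hT hα hαU).trans ?_
  have hbound : ∀ m : ℕ, entPart μ (joinN T (fiberPart a) m) ≤ (m + N) * obsEnt μ g := by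
    intro m
    have hJ := isMPartition_joinN hα hT.measurable m
    have hG : ∀ k : Fin (m + N), IsObs fun x => g (T^[k] x) := fun k => hg.comp_right (hit k)
    rw [← entPart_preC hJ (hT.iterate N)]
    calc _ ≤ entPart μ (fiberPart fun x (k : Fin (m + N)) => g (T^[k] x)) := by
          refine entPart_mono (isMPartition_preC hJ (hit N))
            (isMPartition_fiberPart (IsObs.pi hG)) (refines_fiberPart fun w => ?_)
          let s : ℕ → Set X := fun i => if h : i < m then
            a ⁻¹' {Ψ fun k => w ⟨k + i, by omega⟩} else ∅
          refine ⟨_, Finset.mem_image_of_mem _ (mem_joinN.2 ⟨s, fun i hi => ?_, rfl⟩), ?_⟩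
          · simp only [s, hi, dif_pos]
            exact Finset.mem_image_of_mem _ (Finset.mem_univ _)
          · rintro x rfl i hi
            simp only [s, hi, dif_pos]
            change a _ = _
            simp only [a]
            congr 1
            funext k
            rw [← Function.iterate_add_apply, Nat.add_comm i N, Function.iterate_add_apply,
              hinv', ← Function.iterate_add_apply]
      _ ≤ ∑ k : Fin (m + N), obsEnt μ fun x => g (T^[k] x) := by
          rw [entPart_fiberPart]; exact obsEnt_pi_le hG
      _ = (m + N) * obsEnt μ g := by
          simp [fun k => obsEnt_comp_right hg (hT.iterate k)]
  have hlim : Tendsto (fun m : ℕ => (1 + N / m : ℝ) * obsEnt μ g) atTop (𝓝 (obsEnt μ g)) := by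
    simpa using ((tendsto_const_div_atTop_nhds_zero_nat (N : ℝ)).const_add 1).mul_const (obsEnt μ g)
  refine le_of_tendsto_of_tendsto (tendsto_hPart hT hα) hlim ?_
  filter_upwards [eventually_gt_atTop 0] with m hm
  have hm' : (0 : ℝ) < m := by exact_mod_cast hm
  rw [div_le_iff₀ hm']
  calc _ ≤ _ := hbound m
    _ = _ := by field_simp

end CoverEntropy

/-! ### Rokhlin towers -/

section Towers

variable {μ : Measure X}

lemma iterate_symm_iterate {Y : Type*} [MeasurableSpace Y] (T : Y ≃ᵐ Y) {i j : ℕ} (h : j ≤ i)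
    (x : Y) : T^[j] (T.symm^[i] x) = T.symm^[i - j] x := by
  conv_lhs => rw [← Nat.add_sub_cancel' h, Function.iterate_add_apply]
  exact (T.right_inv : Function.LeftInverse T T.symm).iterate j _

lemma symm_iterate_iterate {Y : Type*} [MeasurableSpace Y] (T : Y ≃ᵐ Y) {i j : ℕ} (h : j ≤ i)
    (x : Y) : T.symm^[j] (T^[i] x) = T^[i - j] x :=
  iterate_symm_iterate T.symm h x

lemma Ergodic.ae_exists_iterate_mem [IsProbabilityMeasure μ] {S : X → X} (hS : Ergodic S μ)
    {A : Set X} (hA : MeasurableSet A) (hA0 : μ A ≠ 0) : ∀ᵐ x ∂μ, ∃ k, S^[k] x ∈ A := by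
  set W := ⋃ k, S^[k] ⁻¹' A with hW
  have hWm : MeasurableSet W := MeasurableSet.iUnion fun k => (hS.measurable.iterate k) hA
  have hsub : S ⁻¹' W ⊆ W := by
    intro x hx
    obtain ⟨k, hk⟩ := Set.mem_iUnion.1 hx
    exact Set.mem_iUnion.2 ⟨k + 1, hk⟩
  rcases hS.ae_empty_or_univ_of_preimage_ae_le hWm.nullMeasurableSet
    (LE.le.eventuallyLE hsub) with h | h
  · refine absurd (measure_mono_null ?_ (ae_eq_empty.1 h)) hA0
    exact fun x hx => Set.mem_iUnion.2 ⟨0, hx⟩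
  · filter_upwards [mem_ae_iff.2 (ae_eq_univ.1 h)] with x hx
    exact Set.mem_iUnion.1 hx

/-- A tower of height `N` over a base `B` whose complement has measure at most `N * μ A`, where
`A` is an arbitrary set of positive measure. -/
lemma exists_tower [IsProbabilityMeasure μ] {T : X ≃ᵐ X} (hT : Ergodic T μ) {A : Set X}
    (hA : MeasurableSet A) (hA0 : μ A ≠ 0) {N : ℕ} (hN : 0 < N) :
    ∃ B, MeasurableSet B ∧
      Pairwise (fun i j : Fin N => Disjoint (T.symm^[i] ⁻¹' B) (T.symm^[j] ⁻¹' B)) ∧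
      μ.real {x | ∀ i < N, T.symm^[i] x ∉ B} ≤ N * μ.real A := by
  let H : ℕ → Set X := fun k => {x | T^[k] x ∈ A ∧ ∀ j < k, T^[j] x ∉ A}
  have hHm : ∀ k, MeasurableSet (H k) := by
    intro k
    have : H k = T^[k] ⁻¹' A ∩ ⋂ j, ⋂ (_ : j < k), (T^[j] ⁻¹' A)ᶜ := by ext x; simp [H]
    rw [this]
    exact ((T.measurable.iterate k) hA).inter (MeasurableSet.iInter fun j =>
      MeasurableSet.iInter fun _ => ((T.measurable.iterate j) hA).compl)
  have hHuniq : ∀ {x k l}, x ∈ H k → x ∈ H l → k = l := by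
    intro x k l hk hl
    rcases lt_trichotomy k l with h | h | h
    · exact (hl.2 k h hk.1).elim
    · exact h
    · exact (hk.2 l h hl.1).elim
  have hHshift : ∀ {x k i}, i ≤ k → T.symm^[i] x ∈ H k → x ∈ H (k - i) := by
    intro x k i hik hx
    have hback : ∀ l, T^[l + i] (T.symm^[i] x) = T^[l] x := fun l => by
      rw [Function.iterate_add_apply, iterate_symm_iterate T le_rfl]; simp
    refine ⟨?_, fun j hj => ?_⟩
    · rw [← hback, Nat.sub_add_cancel hik]; exact hx.1
    · rw [← hback]; exact hx.2 _ (by omega)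
  refine ⟨⋃ m, H (m * N + (N - 1)), MeasurableSet.iUnion fun m => hHm _, ?_, ?_⟩
  · intro i j hij
    rw [Set.disjoint_left]
    intro x hxi hxj
    obtain ⟨m, hm⟩ := Set.mem_iUnion.1 hxi
    obtain ⟨l, hl⟩ := Set.mem_iUnion.1 hxj
    have h := hHuniq (hHshift (by omega) hm) (hHshift (by omega) hl)
    have h1 : m * N + (N - 1 - i) = l * N + (N - 1 - j) := by omega
    have h2 := congrArg (· % N) h1
    simp only [Nat.mul_add_mod', Nat.mod_eq_of_lt
      (show N - 1 - (i : ℕ) < N by omega), Nat.mod_eq_of_lt (show N - 1 - (j : ℕ) < N by omega)]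
      at h2
    exact hij (Fin.ext (by omega))
  · have hsub : ∀ᵐ x ∂μ, x ∈ {x | ∀ i < N, T.symm^[i] x ∉ ⋃ m, H (m * N + (N - 1))} →
        x ∈ ⋃ s ∈ Finset.range N, T.symm^[s] ⁻¹' A := by
      filter_upwards [hT.ae_exists_iterate_mem hA hA0] with x hx hxR
      let k := Nat.find hx
      have hk : T^[k] x ∈ A := Nat.find_spec hx
      have hk' : ∀ j < k, T^[j] x ∉ A := fun j hj => Nat.find_min hx hj
      have hdiv : k / N * N + k % N = k := Nat.div_add_mod' k N
      have hmod : k % N < N := Nat.mod_lt _ hN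
      have hz := hxR (N - 1 - k % N) (by omega)
      have hz' : T.symm^[N - 1 - k % N] x ∉ H (k / N * N + (N - 1)) :=
        fun h => hz (Set.mem_iUnion.2 ⟨_, h⟩)
      have hfwd : ∀ l, T^[l + (N - 1 - k % N)] (T.symm^[N - 1 - k % N] x) = T^[l] x := fun l => by
        rw [Function.iterate_add_apply, iterate_symm_iterate T le_rfl]; simp
      have hex : ∃ j < k / N * N + (N - 1), T^[j] (T.symm^[N - 1 - k % N] x) ∈ A := by
        by_contra! hcon
        refine hz' ⟨?_, hcon⟩
        rw [show k / N * N + (N - 1) = k + (N - 1 - k % N) by omega, hfwd]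
        exact hk
      obtain ⟨j, hj, hjA⟩ := hex
      rcases le_or_gt j (N - 1 - k % N) with h | h
      · rw [iterate_symm_iterate T h] at hjA
        exact Set.mem_biUnion (Finset.mem_coe.2 (Finset.mem_range.2 (by omega))) hjA
      · refine (hk' (j - (N - 1 - k % N)) (by omega) ?_).elim
        rwa [← hfwd, Nat.sub_add_cancel h.le]
    have hsymm : MeasurePreserving T.symm μ μ := hT.toMeasurePreserving.symm T
    have hle : μ {x | ∀ i < N, T.symm^[i] x ∉ ⋃ m, H (m * N + (N - 1))} ≤ N * μ A :=
      calc _ ≤ μ (⋃ s ∈ Finset.range N, T.symm^[s] ⁻¹' A) := measure_mono_ae hsub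
        _ ≤ ∑ s ∈ Finset.range N, μ (T.symm^[s] ⁻¹' A) := measure_biUnion_finset_le _ _
        _ = N * μ A := by
          simp [fun s => (hsymm.iterate s).measure_preimage hA.nullMeasurableSet]
    have := ENNReal.toReal_mono (by finiteness) hle
    simpa [measureReal_def] using this

/-- Among disjoint sets, one sees at most its share of the entropy of an observable. -/
lemma exists_mul_condEntropy_le [IsProbabilityMeasure μ] {N : ℕ} (hN : 0 < N)
    {L : Fin N → Set X} (hL : ∀ i, MeasurableSet (L i))
    (hd : Pairwise fun i j => Disjoint (L i) (L j))
    {ι : Type*} [Fintype ι] {b : X → ι} (hb : IsObs b) :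
    ∑ i, μ.real (L i) ≤ 1 ∧ ∃ i, N * (∑ k, Real.negMulLog (μ.real (L i ∩ b ⁻¹' {k})) -
      Real.negMulLog (μ.real (L i))) ≤ obsEnt μ b := by
  let l : X → Option (Fin N) := fun x => if h : ∃ i, x ∈ L i then some h.choose else none
  have hl : ∀ i, l ⁻¹' {some i} = L i := by
    intro i
    ext x
    by_cases h : ∃ j, x ∈ L j
    · simp only [l, Set.mem_preimage, h, dif_pos, Set.mem_singleton_iff, Option.some.injEq]
      refine ⟨?_, fun hx => ?_⟩
      · rintro rfl; exact h.choose_spec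
      · by_contra hne
        exact Set.disjoint_left.1 (hd hne) h.choose_spec hx
    · simp only [l, Set.mem_preimage, h, dif_neg, not_false_eq_true, Set.mem_singleton_iff,
        reduceCtorEq, false_iff]
      exact fun hx => h ⟨i, hx⟩
  have hlo : IsObs l := by
    rintro (_ | i)
    · have : l ⁻¹' {none} = (⋃ i, L i)ᶜ := by
        ext x; simp [l]
      rw [this]
      exact (MeasurableSet.iUnion hL).compl
    · rw [hl]; exact hL i
  have hsum := hlo.sum_measureReal_inter (μ := μ) Set.univ
  rw [Fintype.sum_option] at hsum
  simp only [Set.univ_inter, hl, probReal_univ] at hsum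
  refine ⟨by linarith [measureReal_nonneg (μ := μ) (s := l ⁻¹' {none})], ?_⟩
  have hsub := obsEnt_prodMk_le (μ := μ) hlo hb
  have hnone : Real.negMulLog (μ.real (l ⁻¹' {none})) ≤
      ∑ k, Real.negMulLog (μ.real (l ⁻¹' {none} ∩ b ⁻¹' {k})) := by
    rw [← hb.sum_measureReal_inter]
    exact negMulLog_sum_le _ _ fun _ => measureReal_nonneg
  rw [obsEnt_prodMk, Fintype.sum_option, obsEnt, Fintype.sum_option] at hsub
  simp only [hl] at hsub
  have hN' : (0 : ℝ) < N := by exact_mod_cast hN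
  have : NeZero N := ⟨hN.ne'⟩
  obtain ⟨i, -, hi⟩ := Finset.exists_le_of_sum_le (s := (Finset.univ : Finset (Fin N)))
    (f := fun i => ∑ k, Real.negMulLog (μ.real (L i ∩ b ⁻¹' {k})) - Real.negMulLog (μ.real (L i)))
    (g := fun _ => obsEnt μ b / N) Finset.univ_nonempty (by
      rw [Finset.sum_sub_distrib, Finset.sum_const, Finset.card_univ, Fintype.card_fin,
        nsmul_eq_mul, mul_div_cancel₀ _ hN'.ne']
      linarith)
  exact ⟨i, by rwa [le_div_iff₀' hN'] at hi⟩

/-- A Rokhlin tower whose base sees at most its share of the entropy of a given observable. -/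
lemma exists_tower_condEntropy_le [IsProbabilityMeasure μ] {T : X ≃ᵐ X} (hT : Ergodic T μ)
    {A : Set X} (hA : MeasurableSet A) (hA0 : μ A ≠ 0) {N : ℕ} (hN : 0 < N)
    {ι : Type*} [Fintype ι] {b : X → ι} (hb : IsObs b) :
    ∃ B, MeasurableSet B ∧ N * μ.real B ≤ 1 ∧
      μ.real {x | ∀ i < N, T.symm^[i] x ∉ B} ≤ N * μ.real A ∧
      N * (∑ k, Real.negMulLog (μ.real (B ∩ b ⁻¹' {k})) - Real.negMulLog (μ.real B)) ≤
        obsEnt μ b := by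
  obtain ⟨B, hB, hd, hR⟩ := exists_tower hT hA hA0 hN
  have hsymm : ∀ i, MeasurePreserving (T.symm^[i]) μ μ :=
    fun i => (hT.toMeasurePreserving.symm T).iterate i
  obtain ⟨hsum, j, hj⟩ := exists_mul_condEntropy_le (μ := μ) hN
    (fun i => (hsymm i).measurable hB) hd hb
  have hμ : ∀ i, μ.real (T.symm^[i] ⁻¹' B) = μ.real B := fun i => by
    rw [measureReal_def, (hsymm i).measure_preimage hB.nullMeasurableSet, measureReal_def]
  refine ⟨T.symm^[j] ⁻¹' B, (hsymm j).measurable hB, ?_, ?_, hj⟩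
  · simpa [hμ] using hsum
  · have hRm : MeasurableSet {x | ∀ i < N, T.symm^[i] x ∉ B} := by
      have : {x | ∀ i < N, T.symm^[i] x ∉ B} = ⋂ i, ⋂ (_ : i < N), (T.symm^[i] ⁻¹' B)ᶜ := by
        ext x; simp
      rw [this]
      exact MeasurableSet.iInter fun i => MeasurableSet.iInter fun _ =>
        ((hsymm i).measurable hB).compl
    refine le_trans (le_of_eq ?_) hR
    rw [measureReal_def, measureReal_def, ← (hsymm j).measure_preimage hRm.nullMeasurableSet]
    congr 2
    ext x
    simp only [Set.mem_ofPred_eq, Set.mem_preimage, ← Function.iterate_add_apply, add_comm]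

/-- Gluing observables defined on two disjoint sets. -/
lemma exists_obs_glue [IsProbabilityMeasure μ] {ι κ : Type*} [Fintype ι] [Fintype κ] {B R : Set X}
    (hB : MeasurableSet B) (hR : MeasurableSet R) (hBR : Disjoint B R) {b : X → ι} {u : X → κ}
    (hb : IsObs b) (hu : IsObs u) :
    ∃ g : X → Option (ι ⊕ κ), IsObs g ∧
      (∀ z k, g z = some (Sum.inl k) ↔ z ∈ B ∧ b z = k) ∧
      (∀ z k, g z = some (Sum.inr k) ↔ z ∈ R ∧ u z = k) ∧
      obsEnt μ g ≤ ∑ k, Real.negMulLog (μ.real (B ∩ b ⁻¹' {k})) +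
        ∑ k, Real.negMulLog (μ.real (R ∩ u ⁻¹' {k})) + μ.real B + μ.real R := by
  let g : X → Option (ι ⊕ κ) := fun z =>
    if z ∈ B then some (Sum.inl (b z)) else if z ∈ R then some (Sum.inr (u z)) else none
  have h1 : ∀ z k, g z = some (Sum.inl k) ↔ z ∈ B ∧ b z = k := by
    intro z k
    by_cases hz : z ∈ B
    · simp [g, hz]
    · by_cases hz' : z ∈ R <;> simp [g, hz, hz']
  have h2 : ∀ z k, g z = some (Sum.inr k) ↔ z ∈ R ∧ u z = k := by
    intro z k
    by_cases hz : z ∈ B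
    · simp [g, hz, Set.disjoint_left.1 hBR hz]
    · by_cases hz' : z ∈ R <;> simp [g, hz, hz']
  have h1' : ∀ k, g ⁻¹' {some (Sum.inl k)} = B ∩ b ⁻¹' {k} := fun k => Set.ext fun z => h1 z k
  have h2' : ∀ k, g ⁻¹' {some (Sum.inr k)} = R ∩ u ⁻¹' {k} := fun k => Set.ext fun z => h2 z k
  have h3 : g ⁻¹' {none} = (B ∪ R)ᶜ := by
    ext z
    by_cases hz : z ∈ B
    · simp [g, hz]
    · by_cases hz' : z ∈ R <;> simp [g, hz, hz']
  refine ⟨g, ?_, h1, h2, ?_⟩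
  · rintro (_ | k | k)
    · rw [h3]; exact (hB.union hR).compl
    · rw [h1']; exact hB.inter (hb k)
    · rw [h2']; exact hR.inter (hu k)
  · rw [obsEnt, Fintype.sum_option, Fintype.sum_sum_type]
    simp only [h1', h2', h3]
    have := negMulLog_le_one_sub (measureReal_nonneg (μ := μ) (s := (B ∪ R)ᶜ))
    rw [probReal_compl_eq_one_sub (hB.union hR), measureReal_union hBR hR] at this
    rw [probReal_compl_eq_one_sub (hB.union hR), measureReal_union hBR hR]
    linarith

end Towers

/-! ### The equality of the two entropies -/

section Main

variable {μ : Measure X} [IsProbabilityMeasure μ]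

lemma IsMPartition.sum_measureReal {α : Finset (Set X)} (hα : IsMPartition α) :
    ∑ A ∈ α, μ.real A = 1 := by
  obtain ⟨f, hf, hfo, -⟩ := exists_obs_of_isMPartition (μ := μ) hα
  have := hfo.sum_measureReal_inter (μ := μ) Set.univ
  simp only [Set.univ_inter, hf, probReal_univ] at this
  rw [← this]
  exact (Finset.sum_coe_sort α fun A => μ.real A).symm

/-- A measure whose positive values are bounded away from zero has bounded partition entropies, so
its dynamics have zero entropy. -/
lemma hPart_le_zero_of_le_measureReal {S : X → X} (hS : MeasurePreserving S μ μ) {ε : ℝ}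
    (hε : 0 < ε) (hμ : ∀ A, MeasurableSet A → μ.real A ≠ 0 → ε ≤ μ.real A)
    {α : Finset (Set X)} (hα : IsMPartition α) : hPart μ S α ≤ 0 := by
  have hbound : ∀ β : Finset (Set X), IsMPartition β → entPart μ β ≤ ε⁻¹ := by
    intro β hβ
    calc entPart μ β ≤ ∑ A ∈ β, μ.real A * ε⁻¹ := by
          refine Finset.sum_le_sum fun A hA => ?_
          change Real.negMulLog (μ.real A) ≤ _
          by_cases h0 : μ.real A = 0
          · simp [h0]
          · calc _ ≤ 1 - μ.real A := negMulLog_le_one_sub measureReal_nonneg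
              _ ≤ 1 := by linarith [measureReal_nonneg (μ := μ) (s := A)]
              _ ≤ _ := by
                rw [← div_eq_mul_inv, one_le_div hε]
                exact hμ A (hβ.1.1 A hA) h0
      _ = ε⁻¹ := by rw [← Finset.sum_mul, hβ.sum_measureReal, one_mul]
  refine le_of_tendsto_of_tendsto' (tendsto_hPart hS hα)
    (tendsto_const_div_atTop_nhds_zero_nat ε⁻¹) fun n => ?_
  gcongr
  exact hbound _ (isMPartition_joinN hα hS.measurable n)

lemma hPlusC_le_hMinusC_of_exists_small {T : X ≃ᵐ X} (hT : Ergodic T μ) {U : Finset (Set X)}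
    (hU : IsMCover U)
    (hμ : ∀ ε > 0, ∃ A, MeasurableSet A ∧ μ.real A ≠ 0 ∧ μ.real A < ε) :
    hPlusC μ T U ≤ hMinusC μ T U := by
  have hTm := hT.toMeasurePreserving
  have := nonempty_of_isProbabilityMeasure μ
  refine le_of_forall_pos_le_add fun ε' hε' => ?_
  obtain ⟨ε, hε, rfl⟩ : ∃ ε > 0, ε' = 6 * ε := ⟨ε' / 6, by positivity, by ring⟩
  obtain ⟨u, hu, huU⟩ := exists_obs_mem_cover hU
  set K : ℝ := (Fintype.card U : ℝ) with hK
  have hK0 : 0 ≤ K := by positivity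
  obtain ⟨δ, hδ, hδη⟩ : ∃ δ > 0, ∀ x : ℝ, 0 ≤ x → x < δ →
      Real.negMulLog x < ε ∧ K * Real.negMulLog x ≤ ε := by
    obtain ⟨δ, hδ, h⟩ := Metric.continuousAt_iff.1
      (Real.continuous_negMulLog.continuousAt (x := 0)) (ε / (K + 1)) (by positivity)
    refine ⟨δ, hδ, fun x hx hxδ => ?_⟩
    have h1 : Real.negMulLog x < ε / (K + 1) := by
      have := h (x := x) (by simpa [abs_of_nonneg hx] using hxδ)
      simp only [Real.negMulLog_zero, Real.dist_eq, sub_zero] at this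
      exact (abs_lt.1 this).2
    have h2 : ε / (K + 1) * (K + 1) = ε := by field_simp
    constructor <;> nlinarith [div_pos hε (show 0 < K + 1 by positivity)]
  have hinv := tendsto_const_div_atTop_nhds_zero_nat (1 : ℝ)
  obtain ⟨N, hNε, hNδ, hNh, hN⟩ := (((hinv.eventually_lt_const hε).and
    ((hinv.eventually_lt_const hδ).and (((tendsto_hMinusC hTm hU).eventually_lt_const
      (lt_add_of_pos_right _ hε)).and (eventually_gt_atTop 0))))).exists
  obtain ⟨M, rfl⟩ := Nat.exists_eq_succ_of_ne_zero hN.ne'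
  have hN' : (0 : ℝ) < (M + 1 : ℕ) := by exact_mod_cast hN
  obtain ⟨β, hβ, hβU, hβe⟩ :=
    exists_entPart_lt (μ := μ) (isMCover_joinN hU hTm.measurable (M + 1)) hε
  obtain ⟨b, hbfib, hb, hbe⟩ := exists_obs_of_isMPartition (μ := μ) hβ
  obtain ⟨A, hA, hA0, hAs⟩ := hμ (min δ ε / (M + 1 : ℕ)) (by positivity)
  rw [lt_div_iff₀' hN', lt_min_iff] at hAs
  obtain ⟨B, hB, hBN, hBR, hBb⟩ :=
    exists_tower_condEntropy_le hT hA (fun h => hA0 (by simp [measureReal_def, h])) hN hb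
  set R := {x | ∀ i < M + 1, T.symm^[i] x ∉ B} with hRdef
  have hR : MeasurableSet R := by
    have : R = ⋂ i, ⋂ (_ : i < M + 1), (T.symm^[i] ⁻¹' B)ᶜ := by ext x; simp [R]
    rw [this]
    exact MeasurableSet.iInter fun i => MeasurableSet.iInter fun _ =>
      ((T.symm.measurable.iterate i) hB).compl
  have hdisj : Disjoint B R := Set.disjoint_left.2 fun x hx hxR => hxR 0 hN hx
  obtain ⟨g, hg, hgB, hgR, hge⟩ := exists_obs_glue (μ := μ) hB hR hdisj hb hu
  have hgU : ∀ w : Fin (M + 1) → Option (β ⊕ U), ∃ V ∈ U,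
      ∀ y, (∀ k : Fin (M + 1), g (T^[k] y) = w k) → T^[M] y ∈ V := by
    intro w
    by_cases hw : ∃ y, ∀ k : Fin (M + 1), g (T^[k] y) = w k
    · obtain ⟨y, hy⟩ := hw
      by_cases hyR : T^[M] y ∈ R
      · refine ⟨u (T^[M] y), (u _).2, fun z hz => ?_⟩
        have hgz : g (T^[M] z) = g (T^[M] y) :=
          (hz (Fin.last M)).trans (hy (Fin.last M)).symm
        rw [(hgR (T^[M] y) _).2 ⟨hyR, rfl⟩, hgR] at hgz
        rw [← hgz.2]
        exact huU _
      · simp only [hRdef, Set.mem_ofPred_eq, not_forall, not_not] at hyR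
        obtain ⟨i, hi, hiB⟩ := hyR
        rw [symm_iterate_iterate T (by omega)] at hiB
        obtain ⟨V, hV, hbV⟩ := hβU _ (b (T^[M - i] y)).2
        obtain ⟨s, hs, rfl⟩ := mem_joinN.1 hV
        refine ⟨s i, hs i hi, fun z hz => ?_⟩
        have hgz : g (T^[M - i] z) = g (T^[M - i] y) :=
          (hz ⟨M - i, by omega⟩).trans (hy ⟨M - i, by omega⟩).symm
        rw [(hgB (T^[M - i] y) _).2 ⟨hiB, rfl⟩, hgB] at hgz
        have hmem : T^[M - i] z ∈ (b (T^[M - i] y) : Set X) := by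
          rw [← hbfib]
          exact hgz.2
        have := hbV hmem i hi
        rwa [← Function.iterate_add_apply, Nat.add_sub_cancel' (by omega)] at this
    · exact ⟨u (Classical.arbitrary X), (u _).2, fun y hy => (hw ⟨y, hy⟩).elim⟩
  refine (hPlusC_le_obsEnt hTm hg hgU).trans (hge.trans ?_)
  have hμB : μ.real B ≤ 1 / (M + 1 : ℕ) := by rwa [le_div_iff₀' hN']
  have hηB := (hδη _ measureReal_nonneg (hμB.trans_lt hNδ)).1
  have hηR : ∑ k, Real.negMulLog (μ.real (R ∩ u ⁻¹' {k})) ≤ ε := by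
    have hle : ∀ k ∈ (Finset.univ : Finset U), K * Real.negMulLog (μ.real (R ∩ u ⁻¹' {k})) ≤ ε :=
      fun k _ => (hδη _ measureReal_nonneg
        (((measureReal_mono Set.inter_subset_left).trans hBR).trans_lt hAs.1)).2
    have hK1 : 0 < K := by
      have : Nonempty U := ⟨u (Classical.arbitrary X)⟩
      simpa [hK] using Fintype.card_pos (α := U)
    have := Finset.sum_le_sum hle
    rw [← Finset.mul_sum, Finset.sum_const, Finset.card_univ, nsmul_eq_mul] at this
    exact le_of_mul_le_mul_left this hK1
  have hηb : ∑ k, Real.negMulLog (μ.real (B ∩ b ⁻¹' {k})) ≤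
      Real.negMulLog (μ.real B) + hMinusC μ T U + 2 * ε := by
    rw [div_lt_iff₀ hN'] at hNh
    rw [← hbe] at hBb
    have h1 : (1 : ℝ) ≤ (M + 1 : ℕ) := by exact_mod_cast hN
    have h2 : ((M + 1 : ℕ) : ℝ) * (∑ k, Real.negMulLog (μ.real (B ∩ b ⁻¹' {k})) -
        Real.negMulLog (μ.real B)) ≤ (M + 1 : ℕ) * (hMinusC μ T U + 2 * ε) := by nlinarith
    linarith [le_of_mul_le_mul_left h2 hN']
  linarith [hAs.2]

end Main

/-- For an ergodic m.t.d.s. `(X, 𝓑, μ, T)` and a cover `𝓤`,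
`h_μ⁺(𝓤, T) = h_μ⁻(𝓤, T)`. -/
theorem hPlus_eq_hMinus_ergodic {X : Type*} [MeasurableSpace X] [StandardBorelSpace X]
    (μ : Measure X) [IsProbabilityMeasure μ] (T : X ≃ᵐ X)
    (herg : Ergodic ⇑T μ)
    (U : Finset (Set X)) (hU : IsMCover U) :
    hPlusC μ ⇑T U = hMinusC μ ⇑T U := by
  refine le_antisymm ?_ (hMinusC_le_hPlusC herg.toMeasurePreserving hU)
  by_cases hμ : ∀ ε > 0, ∃ A, MeasurableSet A ∧ μ.real A ≠ 0 ∧ μ.real A < ε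
  · exact hPlusC_le_hMinusC_of_exists_small herg hU hμ
  · push Not at hμ
    obtain ⟨ε, hε, hμ⟩ := hμ
    have := nonempty_of_isProbabilityMeasure μ
    obtain ⟨α, hα, hαU⟩ := exists_isMPartition_refines hU
    have hT := herg.toMeasurePreserving
    exact ((hPlusC_le hT hα hαU).trans (hPart_le_zero_of_le_measureReal hT hε hμ hα)).trans
      (hMinusC_nonneg hT hU)
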